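/- For every preorder ℙ, the Knaster invariant 𝒦₂(ℙ) belongs to spec(ℙ). -/

import Mathlib

universe u

/-- Two elements of a preorder are *compatible* if they have a common lower bound. -/
def PCompat {α : Type u} [Preorder α] (p q : α) : Prop := ∃ r, r ≤ p ∧ r ≤ q

/-- An *antichain*: a set of pairwise incompatible elements. -/
def PAntichain {α : Type u} [Preorder α] (A : Set α) : Prop :=
  A.Pairwise fun p q => ¬ PCompat p q

/-- The *cellularity* of a preorder: the supremum of ℵ₀ and the cardinalities of antichains. -/
noncomputable def cellularity (α : Type u) [Preorder α] : Cardinal.{u} :=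
  max Cardinal.aleph0
    (sSup {c : Cardinal.{u} | ∃ A : Set α, PAntichain A ∧ c = Cardinal.mk ↑A})

/-- The *cellular spectrum* of a preorder: the infinite cardinals κ such that the product
with any preorder of cellularity at most κ has cellularity at most κ. -/
def cellSpec (α : Type u) [Preorder α] : Set Cardinal.{u} :=
  {κ | Cardinal.aleph0 ≤ κ ∧
    ∀ (β : Type u) [Preorder β], cellularity β ≤ κ → cellularity (α × β) ≤ κ}

/-- A subset A of a preorder is *n-linked* if every n-element subset of A has a common
lower bound. -/
def NLinked {α : Type u} [Preorder α] (n : ℕ) (A : Set α) : Prop :=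
  ∀ F : Finset α, ↑F ⊆ A → F.card = n → ∃ r : α, ∀ p ∈ F, r ≤ p

/-- The *Knaster invariant* 𝒦ₙ(α): the least infinite cardinal κ such that every subset
of cardinality κ⁺ has an n-linked subset of cardinality κ⁺. -/
noncomputable def knaster (α : Type u) [Preorder α] (n : ℕ) : Cardinal.{u} :=
  sInf {κ : Cardinal.{u} | Cardinal.aleph0 ≤ κ ∧
    ∀ A : Set α, Cardinal.mk ↑A = Order.succ κ →
      ∃ B ⊆ A, NLinked n B ∧ Cardinal.mk ↑B = Order.succ κ}

/-- The Knaster invariant 𝒦₂(ℙ) belongs to spec(ℙ). -/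
theorem knaster_two_mem_cellSpec {α : Type u} [Preorder α] : knaster α 2 ∈ cellSpec α := by
  classical
  have hne : {κ : Cardinal.{u} | Cardinal.aleph0 ≤ κ ∧
    ∀ A : Set α, Cardinal.mk ↑A = Order.succ κ →
      ∃ B ⊆ A, NLinked 2 B ∧ Cardinal.mk ↑B = Order.succ κ}.Nonempty := by
    refine ⟨max Cardinal.aleph0 (Cardinal.mk α), le_max_left _ _, ?_⟩
    intro A hA
    exfalso
    have h1 : Cardinal.mk A ≤ max Cardinal.aleph0 (Cardinal.mk α) :=
      (Cardinal.mk_set_le A).trans (le_max_right _ _)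
    rw [hA] at h1
    exact absurd h1 (not_le.2 (Order.lt_succ _))
  have hmem := csInf_mem hne
  change knaster α 2 ∈ _ at hmem
  obtain ⟨hω, hK⟩ := hmem
  generalize knaster α 2 = κ at hω hK
  refine ⟨hω, ?_⟩
  intro β _ hβ
  have hanti : ∀ D : Set β, PAntichain D → Cardinal.mk D ≤ κ := by
    intro D hD
    refine le_trans ?_ ((le_max_right _ _).trans hβ)
    refine le_csSup ⟨Cardinal.mk β, ?_⟩ ⟨D, hD, rfl⟩
    rintro c ⟨E, -, rfl⟩
    exact Cardinal.mk_set_le E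
  refine max_le hω (csSup_le' ?_)
  rintro c ⟨A, hA, rfl⟩
  have H : ∀ C ⊆ A, (∀ x ∈ C, ∀ y ∈ C, PCompat x.1 y.1) → Cardinal.mk C ≤ κ := by
    intro C hCA hC
    have hkey : ∀ x ∈ C, ∀ y ∈ C, PCompat x.2 y.2 → x = y := by
      intro x hx y hy ⟨s, hs1, hs2⟩
      by_contra hxy
      obtain ⟨r, hr1, hr2⟩ := hC x hx y hy
      exact hA (hCA hx) (hCA hy) hxy ⟨(r, s), ⟨hr1, hs1⟩, ⟨hr2, hs2⟩⟩
    have hinj : Set.InjOn Prod.snd C := by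
      intro x hx y hy hxy
      exact hkey x hx y hy ⟨x.2, le_rfl, hxy.le⟩
    have hD : PAntichain (Prod.snd '' C) := by
      rintro _ ⟨x, hx, rfl⟩ _ ⟨y, hy, rfl⟩ hne hc
      exact hne (by rw [hkey x hx y hy hc])
    rw [← Cardinal.mk_image_eq_of_injOn _ _ hinj]
    exact hanti _ hD
  have hfst : Cardinal.mk (Prod.fst '' A) ≤ κ := by
    by_contra hlt
    have hs : Order.succ κ ≤ Cardinal.mk (Prod.fst '' A) := Order.succ_le_of_lt (not_le.1 hlt)
    obtain ⟨A', hA', hA'c⟩ := Cardinal.le_mk_iff_exists_subset.1 hs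
    obtain ⟨B, hBA, hB, hBc⟩ := hK A' hA'c
    have hch : ∀ b : B, ∃ x ∈ A, x.1 = b.1 := fun b => hA' (hBA b.2)
    choose f hfA hf using hch
    have hfi : Function.Injective f := by
      intro b c h
      apply Subtype.ext
      rw [← hf b, ← hf c, h]
    have h1 := H (Set.range f) (by rintro _ ⟨b, rfl⟩; exact hfA b) (by
      rintro _ ⟨b, rfl⟩ _ ⟨c, rfl⟩
      rw [hf b, hf c]
      by_cases hbc : b.1 = c.1
      · exact ⟨b.1, le_rfl, hbc.le⟩
      · obtain ⟨r, hr⟩ := hB {b.1, c.1} (by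
          intro z hz
          simp only [Finset.coe_insert, Finset.coe_singleton, Set.mem_insert_iff,
            Set.mem_singleton_iff] at hz
          rcases hz with rfl | rfl
          · exact b.2
          · exact c.2) (Finset.card_pair hbc)
        exact ⟨r, hr _ (by simp), hr _ (by simp)⟩)
    rw [Cardinal.mk_range_eq f hfi, hBc] at h1
    exact absurd h1 (not_le.2 (Order.lt_succ _))
  have hcov : A ⊆ ⋃ a : (Prod.fst '' A), {x ∈ A | x.1 = a.1} := by
    intro x hx
    exact Set.mem_iUnion.2 ⟨⟨x.1, x, hx, rfl⟩, hx, rfl⟩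
  refine (Cardinal.mk_le_mk_of_subset hcov).trans ((Cardinal.mk_iUnion_le _).trans ?_)
  refine (mul_le_mul' hfst (ciSup_le' ?_)).trans (Cardinal.mul_eq_self hω).le
  intro a
  refine H _ (fun x hx => hx.1) ?_
  intro x hx y hy
  exact ⟨x.1, le_rfl, (hx.2.trans hy.2.symm).le⟩
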